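/- Let E be a real inner product space, N ≥ 1, K ≥ 1, and f_1,…,f_N : E → ℝ differentiable with L-Lipschitz gradient (L ≥ 0), with global objective f = (1/N)·Σ_i f_i. Let L₋ ≥ 0 be such that each f_i is L₋-weakly convex (θ ↦ f_i(θ) + (L₋/2)‖θ‖² is convex), let α > L₋ and set ᾱ = α − L₋ > 0. Let ψ ≥ 0, B ≥ 0, w ∈ E, and suppose: (a) each θ_i ∈ E is a ψ-inexact solution, i.e. ‖∇f_i(θ_i) + α·(θ_i − w)‖ ≤ ψ·‖∇f_i(w)‖; (b) the family (f_i) is B-dissimilar at w, i.e. (1/N)·Σ_i ‖∇f_i(w)‖² ≤ B²·‖∇f(w)‖². For each tuple s : {1,…,K} → {1,…,N} let W(s) = (1/K)·Σ_{k=1}^K θ_{s(k)} be the aggregated next global model. Then the expectation over uniform client sampling satisfies (1/N^K)·Σ_s f(W(s)) ≤ f(w) − [ (1 − ψ·B)/α − √2·B·(1 + ψ)/(ᾱ·√K) − L·B·(1 + ψ)/(ᾱ·α) − L·B²·(1 + ψ)²·( 1/2 + (2·√(2·K) + 2)/K )/ᾱ² ]·‖∇f(w)‖². -/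

import Mathlib

open Finset

lemma aux_line {E : Type*} [NormedAddCommGroup E] [InnerProductSpace ℝ E] [CompleteSpace E]
    (f : E → ℝ) (hf : Differentiable ℝ f) (y v : E) (t : ℝ) :
    HasDerivAt (fun t : ℝ => f (y + t • v)) (inner ℝ (gradient f (y + t • v)) v) t := by
  have h1 : HasDerivAt (fun t : ℝ => y + t • v) v t := by
    simpa using ((hasDerivAt_id t).smul_const v).const_add y
  have h2 := (hf (y + t • v)).hasGradientAt.hasFDerivAt
  have h3 := h2.comp_hasDerivAt t h1
  simpa [Function.comp_def] using h3

lemma aux_descent {E : Type*} [NormedAddCommGroup E] [InnerProductSpace ℝ E] [CompleteSpace E]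
    (f : E → ℝ) (hf : Differentiable ℝ f) (L : ℝ)
    (hs : ∀ x y : E, ‖gradient f x - gradient f y‖ ≤ L * ‖x - y‖) (y v : E) :
    f (y + v) ≤ f y + inner ℝ (gradient f y) v + L / 2 * ‖v‖ ^ 2 := by
  have hd : ∀ t : ℝ, HasDerivAt
      (fun t : ℝ => f (y + t • v) - t * inner ℝ (gradient f y) v - L / 2 * ‖v‖ ^ 2 * t ^ 2)
      (inner ℝ (gradient f (y + t • v)) v - inner ℝ (gradient f y) v - L * ‖v‖ ^ 2 * t) t := by
    intro t
    have h := ((aux_line f hf y v t).sub ((hasDerivAt_id t).mul_const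
      (inner ℝ (gradient f y) v))).sub ((hasDerivAt_pow 2 t).const_mul (L / 2 * ‖v‖ ^ 2))
    refine HasDerivAt.congr_deriv h ?_
    simp only [Nat.cast_ofNat, one_mul]
    ring
  have hanti := antitoneOn_of_deriv_nonpos (convex_Icc (0 : ℝ) 1)
    (fun t _ => (hd t).continuousAt.continuousWithinAt)
    (fun t _ => (hd t).differentiableAt.differentiableWithinAt)
    (by
      intro t ht
      rw [interior_Icc] at ht
      rw [(hd t).deriv, ← inner_sub_left]
      have h1 := real_inner_le_norm (gradient f (y + t • v) - gradient f y) v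
      have h2 := hs (y + t • v) y
      rw [add_sub_cancel_left, norm_smul, Real.norm_of_nonneg ht.1.le] at h2
      have h3 := mul_le_mul_of_nonneg_right h2 (norm_nonneg v)
      nlinarith)
  have := hanti (Set.left_mem_Icc.2 zero_le_one) (Set.right_mem_Icc.2 zero_le_one) zero_le_one
  simp only [zero_smul, one_smul, add_zero] at this
  linarith

lemma aux_mono {E : Type*} [NormedAddCommGroup E] [InnerProductSpace ℝ E] [CompleteSpace E]
    (f : E → ℝ) (hf : Differentiable ℝ f) (m : ℝ)
    (hc : ConvexOn ℝ Set.univ (fun x : E => f x + (m / 2) * ‖x‖ ^ 2)) (y v : E) :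
    - m * ‖v‖ ^ 2 ≤ inner ℝ (gradient f (y + v) - gradient f y) v := by
  have hd : ∀ t : ℝ, HasDerivAt
      (fun t : ℝ => f (y + t • v) + (m / 2) * ‖y + t • v‖ ^ 2)
      (inner ℝ (gradient f (y + t • v)) v + m * inner ℝ (y + t • v) v) t := by
    intro t
    have h1 : HasDerivAt (fun t : ℝ => y + t • v) v t := by
      simpa using ((hasDerivAt_id t).smul_const v).const_add y
    have h := (aux_line f hf y v t).add (h1.norm_sq.const_mul (m / 2))
    refine HasDerivAt.congr_deriv h ?_
    ring
  have hcl : ConvexOn ℝ Set.univ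
      (fun t : ℝ => f (y + t • v) + (m / 2) * ‖y + t • v‖ ^ 2) := by
    have h := hc.comp_affineMap (AffineMap.lineMap y (y + v) : ℝ →ᵃ[ℝ] E)
    have e : (fun t : ℝ => f (y + t • v) + (m / 2) * ‖y + t • v‖ ^ 2) =
      (fun x : E => f x + (m / 2) * ‖x‖ ^ 2) ∘ (AffineMap.lineMap y (y + v) : ℝ →ᵃ[ℝ] E) := by
      funext t
      simp [AffineMap.lineMap_apply, add_comm]
    rw [e]
    simpa using h
  have h0 := hcl.le_slope_of_hasDerivAt (Set.mem_univ 0) (Set.mem_univ 1) one_pos (hd 0)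
  have h1 := hcl.slope_le_of_hasDerivAt (Set.mem_univ 0) (Set.mem_univ 1) one_pos (hd 1)
  have h2 := h0.trans h1
  simp only [zero_smul, one_smul, add_zero, inner_add_left, real_inner_self_eq_norm_sq] at h2
  rw [inner_sub_left]
  linarith

lemma aux_mean_le {N : ℕ} (hN : 1 ≤ N) (a : Fin N → ℝ) (ha : ∀ i, 0 ≤ a i) (c : ℝ) (hc : 0 ≤ c)
    (h : (1 / (N : ℝ)) * ∑ i, a i ^ 2 ≤ c ^ 2) : (1 / (N : ℝ)) * ∑ i, a i ≤ c := by
  have hN' : (0 : ℝ) < N := by exact_mod_cast hN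
  have h1 := sq_sum_le_card_mul_sum_sq (s := Finset.univ) (f := a)
  simp only [Finset.card_univ, Fintype.card_fin] at h1
  refine (abs_le_of_sq_le_sq' ?_ hc).2
  refine le_trans ?_ h
  rw [mul_pow]
  calc (1 / (N : ℝ)) ^ 2 * (∑ i, a i) ^ 2 ≤ (1 / (N : ℝ)) ^ 2 * (N * ∑ i, a i ^ 2) := by gcongr
    _ = _ := by field_simp

lemma aux_exp {N K : ℕ} (hN : 1 ≤ N) (hK : 1 ≤ K) (φ : Fin N → ℝ) :
    (1 / (N : ℝ) ^ K) * ∑ s : Fin K → Fin N, (1 / (K : ℝ)) * ∑ k, φ (s k)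
      = (1 / (N : ℝ)) * ∑ i, φ i := by
  have hN' : (0 : ℝ) < N := by exact_mod_cast hN
  have hK' : (0 : ℝ) < K := by exact_mod_cast hK
  have h (k : Fin K) : ∑ s : Fin K → Fin N, φ (s k) = (N : ℝ) ^ (K - 1) * ∑ i, φ i := by
    have := Fintype.sum_piFinset_apply φ (Finset.univ : Finset (Fin N)) k
    simpa using this
  rw [← Finset.mul_sum, Finset.sum_comm, Finset.sum_congr rfl (fun k _ => h k)]
  obtain ⟨k, rfl⟩ : ∃ k, K = k + 1 := ⟨K - 1, by omega⟩
  simp only [Finset.sum_const, Finset.card_univ, Fintype.card_fin, nsmul_eq_mul,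
    Nat.add_sub_cancel, pow_succ]
  field_simp

/-- Theorem 1 (Eq. (18)/(34)) of the FedSSG paper: one round of aggregation
with `K` uniformly sampled clients decreases the expected global objective. -/
theorem fedssg_main_descent
    {E : Type*} [NormedAddCommGroup E] [InnerProductSpace ℝ E] [CompleteSpace E]
    (N K : ℕ) (hN : 1 ≤ N) (hK : 1 ≤ K)
    (f : Fin N → E → ℝ) (hf : ∀ i, Differentiable ℝ (f i))
    (L : ℝ) (hL : 0 ≤ L)
    (hsmooth : ∀ i, ∀ x y : E,
      ‖gradient (f i) x - gradient (f i) y‖ ≤ L * ‖x - y‖)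
    (Lm : ℝ) (hLm : 0 ≤ Lm)
    (hweak : ∀ i, ConvexOn ℝ Set.univ
      (fun θ : E => f i θ + (Lm / 2) * ‖θ‖ ^ 2))
    (α : ℝ) (hα : Lm < α)
    (ψ B : ℝ) (hψ : 0 ≤ ψ) (hB : 0 ≤ B)
    (w : E) (θ : Fin N → E)
    (hinexact : ∀ i,
      ‖gradient (f i) (θ i) + α • (θ i - w)‖ ≤ ψ * ‖gradient (f i) w‖)
    (hdis : (1 / (N : ℝ)) * ∑ i, ‖gradient (f i) w‖ ^ 2
        ≤ B ^ 2 * ‖gradient (fun x => (1 / (N : ℝ)) * ∑ i, f i x) w‖ ^ 2) :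
    (1 / (N : ℝ) ^ K) * ∑ s : Fin K → Fin N,
        (fun x => (1 / (N : ℝ)) * ∑ i, f i x) ((1 / (K : ℝ)) • ∑ k, θ (s k))
      ≤ (fun x => (1 / (N : ℝ)) * ∑ i, f i x) w
        - ((1 - ψ * B) / α
            - Real.sqrt 2 * B * (1 + ψ) / ((α - Lm) * Real.sqrt K)
            - L * B * (1 + ψ) / ((α - Lm) * α)
            - L * B ^ 2 * (1 + ψ) ^ 2
                * (1 / 2 + (2 * Real.sqrt (2 * K) + 2) / K) / (α - Lm) ^ 2)
          * ‖gradient (fun x => (1 / (N : ℝ)) * ∑ i, f i x) w‖ ^ 2 := by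
  have hN' : (0 : ℝ) < N := by exact_mod_cast hN
  have hK' : (0 : ℝ) < K := by exact_mod_cast hK
  have hα0 : 0 < α := lt_of_le_of_lt hLm hα
  have hb : 0 < α - Lm := sub_pos.2 hα
  have hG : gradient (fun x => (1 / (N : ℝ)) * ∑ i, f i x) w
      = (1 / (N : ℝ)) • ∑ i, gradient (f i) w := by
    apply HasGradientAt.gradient
    rw [hasGradientAt_iff_hasFDerivAt]
    have h1 := (HasFDerivAt.fun_sum (u := Finset.univ)
      (fun i _ => (hf i w).hasGradientAt.hasFDerivAt)).const_mul (1 / (N : ℝ))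
    refine h1.congr_fderiv ?_
    simp
  set G := gradient (fun x => (1 / (N : ℝ)) * ∑ i, f i x) w with hGdef
  clear_value G
  set c := B * ‖G‖ with hc
  have hc0 : 0 ≤ c := by positivity
  rw [← mul_pow, ← hc] at hdis
  -- bound on the displacement
  have hdi (i : Fin N) : ‖θ i - w‖ ≤ (1 + ψ) / (α - Lm) * ‖gradient (f i) w‖ := by
    have h1 := aux_mono (f i) (hf i) Lm (hweak i) w (θ i - w)
    rw [add_sub_cancel] at h1
    have h2 : (α - Lm) * ‖θ i - w‖ ^ 2 ≤
        inner ℝ ((gradient (f i) (θ i) + α • (θ i - w)) - gradient (f i) w) (θ i - w) := by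
      have : (gradient (f i) (θ i) + α • (θ i - w)) - gradient (f i) w
          = (gradient (f i) (θ i) - gradient (f i) w) + α • (θ i - w) := by abel
      rw [this, inner_add_left, real_inner_smul_left, real_inner_self_eq_norm_sq]
      linarith
    have h3 := real_inner_le_norm
      ((gradient (f i) (θ i) + α • (θ i - w)) - gradient (f i) w) (θ i - w)
    have h4 := norm_sub_le (gradient (f i) (θ i) + α • (θ i - w)) (gradient (f i) w)
    have h5 := hinexact i
    have h6 : (α - Lm) * ‖θ i - w‖ ^ 2 ≤ ((1 + ψ) * ‖gradient (f i) w‖) * ‖θ i - w‖ := by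
      refine h2.trans (h3.trans ?_)
      gcongr
      linarith
    rw [div_mul_eq_mul_div, le_div_iff₀ hb]
    rcases (norm_nonneg (θ i - w)).eq_or_lt with h0 | h0
    · rw [← h0]; simp; positivity
    · nlinarith
  have hg1 : (1 / (N : ℝ)) * ∑ i, ‖gradient (f i) w‖ ≤ c :=
    aux_mean_le hN _ (fun i => norm_nonneg _) c hc0 hdis
  have hd1 : (1 / (N : ℝ)) * ∑ i, ‖θ i - w‖ ≤ (1 + ψ) / (α - Lm) * c := by
    calc (1 / (N : ℝ)) * ∑ i, ‖θ i - w‖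
        ≤ (1 / (N : ℝ)) * ∑ i, (1 + ψ) / (α - Lm) * ‖gradient (f i) w‖ := by
          gcongr with i; exact hdi i
      _ = (1 + ψ) / (α - Lm) * ((1 / (N : ℝ)) * ∑ i, ‖gradient (f i) w‖) := by
          rw [← Finset.mul_sum]; ring
      _ ≤ _ := by gcongr
  have hd2 : (1 / (N : ℝ)) * ∑ i, ‖θ i - w‖ ^ 2 ≤ ((1 + ψ) / (α - Lm)) ^ 2 * c ^ 2 := by
    calc (1 / (N : ℝ)) * ∑ i, ‖θ i - w‖ ^ 2
        ≤ (1 / (N : ℝ)) * ∑ i, ((1 + ψ) / (α - Lm)) ^ 2 * ‖gradient (f i) w‖ ^ 2 := by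
          gcongr with i; rw [← mul_pow]; gcongr; exact hdi i
      _ = ((1 + ψ) / (α - Lm)) ^ 2 * ((1 / (N : ℝ)) * ∑ i, ‖gradient (f i) w‖ ^ 2) := by
          rw [← Finset.mul_sum]; ring
      _ ≤ _ := by gcongr
  -- linear term
  have hlin (i : Fin N) : α * inner ℝ G (θ i - w) ≤
      ‖G‖ * (ψ * ‖gradient (f i) w‖) + ‖G‖ * (L * ‖θ i - w‖) - inner ℝ G (gradient (f i) w) := by
    have e : α • (θ i - w) = (gradient (f i) (θ i) + α • (θ i - w))
        + (gradient (f i) w - gradient (f i) (θ i)) - gradient (f i) w := by abel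
    rw [← real_inner_smul_right, e, inner_sub_right, inner_add_right]
    have h1 := (real_inner_le_norm G (gradient (f i) (θ i) + α • (θ i - w))).trans
      (mul_le_mul_of_nonneg_left (hinexact i) (norm_nonneg G))
    have h2 := (real_inner_le_norm G (gradient (f i) w - gradient (f i) (θ i))).trans
      (mul_le_mul_of_nonneg_left (hsmooth i w (θ i)) (norm_nonneg G))
    rw [norm_sub_rev w] at h2
    linarith
  have hlin2 : α * ((1 / (N : ℝ)) * ∑ i, inner ℝ G (θ i - w)) ≤
      ‖G‖ * ψ * c + ‖G‖ * L * ((1 + ψ) / (α - Lm) * c) - ‖G‖ ^ 2 := by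
    have hGG : (1 / (N : ℝ)) * ∑ i, inner ℝ G (gradient (f i) w) = ‖G‖ ^ 2 := by
      rw [← inner_sum, ← real_inner_smul_right, ← hG, real_inner_self_eq_norm_sq]
    calc α * ((1 / (N : ℝ)) * ∑ i, inner ℝ G (θ i - w))
        = (1 / (N : ℝ)) * ∑ i, α * inner ℝ G (θ i - w) := by rw [← Finset.mul_sum]; ring
      _ ≤ (1 / (N : ℝ)) * ∑ i, (‖G‖ * (ψ * ‖gradient (f i) w‖) + ‖G‖ * (L * ‖θ i - w‖)
            - inner ℝ G (gradient (f i) w)) := by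
          gcongr with i; exact hlin i
      _ = ‖G‖ * ψ * ((1 / (N : ℝ)) * ∑ i, ‖gradient (f i) w‖)
            + ‖G‖ * L * ((1 / (N : ℝ)) * ∑ i, ‖θ i - w‖)
            - (1 / (N : ℝ)) * ∑ i, inner ℝ G (gradient (f i) w) := by
          simp only [Finset.sum_sub_distrib, Finset.sum_add_distrib, ← Finset.mul_sum]; ring
      _ ≤ _ := by rw [hGG]; gcongr
  -- pointwise descent
  have hdesc (s : Fin K → Fin N) :
      (1 / (N : ℝ)) * ∑ i, f i ((1 / (K : ℝ)) • ∑ k, θ (s k)) ≤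
        (1 / (N : ℝ)) * ∑ i, f i w + (1 / (K : ℝ)) * ∑ k,
          (inner ℝ G (θ (s k) - w) + L / 2 * ‖θ (s k) - w‖ ^ 2) := by
    set v := (1 / (K : ℝ)) • ∑ k, (θ (s k) - w) with hv
    have e : (1 / (K : ℝ)) • ∑ k, θ (s k) = w + v := by
      rw [hv, Finset.sum_sub_distrib, smul_sub]
      simp only [Finset.sum_const, Finset.card_univ, Fintype.card_fin]
      rw [← Nat.cast_smul_eq_nsmul ℝ, smul_smul, one_div_mul_cancel hK'.ne', one_smul]
      abel
    have hnv : ‖v‖ ^ 2 ≤ (1 / (K : ℝ)) * ∑ k, ‖θ (s k) - w‖ ^ 2 := by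
      have h1 : ‖v‖ ≤ (1 / (K : ℝ)) * ∑ k, ‖θ (s k) - w‖ := by
        rw [hv, norm_smul, Real.norm_of_nonneg (by positivity)]
        gcongr
        exact norm_sum_le _ _
      have h0 : 0 ≤ (1 / (K : ℝ)) * ∑ k, ‖θ (s k) - w‖ ^ 2 := by positivity
      have h2 := aux_mean_le hK (fun k => ‖θ (s k) - w‖) (fun k => norm_nonneg _)
        (Real.sqrt ((1 / (K : ℝ)) * ∑ k, ‖θ (s k) - w‖ ^ 2)) (Real.sqrt_nonneg _)
        (by rw [Real.sq_sqrt h0])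
      calc ‖v‖ ^ 2 ≤ (Real.sqrt ((1 / (K : ℝ)) * ∑ k, ‖θ (s k) - w‖ ^ 2)) ^ 2 := by
            gcongr; exact h1.trans h2
        _ = _ := Real.sq_sqrt h0
    have hiv : inner ℝ G v = (1 / (K : ℝ)) * ∑ k, inner ℝ G (θ (s k) - w) := by
      rw [hv, real_inner_smul_right, inner_sum]
    have hGv : (1 / (N : ℝ)) * ∑ i, inner ℝ (gradient (f i) w) v = inner ℝ G v := by
      rw [hG, real_inner_smul_left, sum_inner]
    rw [e]
    calc (1 / (N : ℝ)) * ∑ i, f i (w + v)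
        ≤ (1 / (N : ℝ)) * ∑ i, (f i w + inner ℝ (gradient (f i) w) v + L / 2 * ‖v‖ ^ 2) := by
          gcongr with i; exact aux_descent (f i) (hf i) L (hsmooth i) w v
      _ = (1 / (N : ℝ)) * ∑ i, f i w + inner ℝ G v + L / 2 * ‖v‖ ^ 2 := by
          rw [← hGv]
          simp only [Finset.sum_add_distrib, Finset.sum_const, Finset.card_univ,
            Fintype.card_fin, nsmul_eq_mul]
          field_simp
      _ ≤ (1 / (N : ℝ)) * ∑ i, f i w + inner ℝ G v
            + L / 2 * ((1 / (K : ℝ)) * ∑ k, ‖θ (s k) - w‖ ^ 2) := by gcongr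
      _ = _ := by
          rw [hiv, Finset.sum_add_distrib, ← Finset.mul_sum]; ring
  have hmain : (1 / (N : ℝ) ^ K) * ∑ s : Fin K → Fin N,
        (1 / (N : ℝ)) * ∑ i, f i ((1 / (K : ℝ)) • ∑ k, θ (s k)) ≤
      (1 / (N : ℝ)) * ∑ i, f i w + (1 / (N : ℝ)) * ∑ i, inner ℝ G (θ i - w)
        + L / 2 * ((1 / (N : ℝ)) * ∑ i, ‖θ i - w‖ ^ 2) := by
    calc _ ≤ (1 / (N : ℝ) ^ K) * ∑ s : Fin K → Fin N,
          ((1 / (N : ℝ)) * ∑ i, f i w + (1 / (K : ℝ)) * ∑ k,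
          (inner ℝ G (θ (s k) - w) + L / 2 * ‖θ (s k) - w‖ ^ 2)) := by
          gcongr with s; exact hdesc s
      _ = (1 / (N : ℝ)) * ∑ i, f i w + (1 / (N : ℝ)) * ∑ i,
          (inner ℝ G (θ i - w) + L / 2 * ‖θ i - w‖ ^ 2) := by
          rw [← aux_exp hN hK (fun i => inner ℝ G (θ i - w) + L / 2 * ‖θ i - w‖ ^ 2),
            Finset.sum_add_distrib, mul_add]
          congr 1
          simp only [Finset.sum_const, Finset.card_univ, Fintype.card_fun, Fintype.card_fin,
            nsmul_eq_mul, Nat.cast_pow]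
          field_simp
      _ = _ := by
          rw [Finset.sum_add_distrib, ← Finset.mul_sum]; ring
  have hlin3 : (1 / (N : ℝ)) * ∑ i, inner ℝ G (θ i - w) ≤
      (‖G‖ * ψ * c + ‖G‖ * L * ((1 + ψ) / (α - Lm) * c) - ‖G‖ ^ 2) / α := by
    rw [le_div_iff₀ hα0, mul_comm]; exact hlin2
  have hquad := mul_le_mul_of_nonneg_left hd2 (by positivity : 0 ≤ L / 2)
  have hx1 : 0 ≤ Real.sqrt 2 * B * (1 + ψ) / ((α - Lm) * Real.sqrt K) * ‖G‖ ^ 2 := by positivity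
  have hx2 : 0 ≤ L * B ^ 2 * (1 + ψ) ^ 2
      * ((2 * Real.sqrt (2 * K) + 2) / K) / (α - Lm) ^ 2 * ‖G‖ ^ 2 := by positivity
  refine hmain.trans ?_
  have key : (‖G‖ * ψ * c + ‖G‖ * L * ((1 + ψ) / (α - Lm) * c) - ‖G‖ ^ 2) / α
      + L / 2 * (((1 + ψ) / (α - Lm)) ^ 2 * c ^ 2)
      = - ((1 - ψ * B) / α - L * B * (1 + ψ) / ((α - Lm) * α)
        - L * B ^ 2 * (1 + ψ) ^ 2 * (1 / 2) / (α - Lm) ^ 2) * ‖G‖ ^ 2 := by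
    rw [hc]
    field_simp
    ring
  have split : L * B ^ 2 * (1 + ψ) ^ 2
      * (1 / 2 + (2 * Real.sqrt (2 * K) + 2) / K) / (α - Lm) ^ 2
      = L * B ^ 2 * (1 + ψ) ^ 2 * (1 / 2) / (α - Lm) ^ 2 + L * B ^ 2 * (1 + ψ) ^ 2
      * ((2 * Real.sqrt (2 * K) + 2) / K) / (α - Lm) ^ 2 := by ring
  rw [split]
  beta_reduce
  linarith
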